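/- Let 𝒞 be a category and Bun : 𝒞ᵒᵖ ⥤ Cat a strict indexed category. Consider two vertically adjacent squares in the Grothendieck double construction: lenses ⟨f₁♯,f₁⟩ : ⟨A₁,C₁⟩ ⇆ ⟨A₃,C₃⟩, ⟨f₂♯,f₂⟩ : ⟨A₂,C₂⟩ ⇆ ⟨A₄,C₄⟩, ⟨f₃♯,f₃⟩ : ⟨A₃,C₃⟩ ⇆ ⟨A₅,C₅⟩, ⟨f₄♯,f₄⟩ : ⟨A₄,C₄⟩ ⇆ ⟨A₆,C₆⟩, and bundle maps ⟨g₁♯,g₁⟩ : ⟨A₁,C₁⟩ ⇉ ⟨A₂,C₂⟩, ⟨g₂♯,g₂⟩ : ⟨A₃,C₃⟩ ⇉ ⟨A₄,C₄⟩, ⟨g₃♯,g₃⟩ : ⟨A₅,C₅⟩ ⇉ ⟨A₆,C₆⟩. If the upper square commutes (f₁ ≫ g₂ = g₁ ≫ f₂ and g₁♯ ∘ f₁♯ = g₁*(f₂♯) ∘ ι ∘ f₁*(g₂♯)) and the lower square commutes (f₃ ≫ g₃ = g₂ ≫ f₄ and g₂♯ ∘ f₃♯ = g₂*(f₄♯)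 ∘ ι' ∘ f₃*(g₃♯)), then the vertical composite square, with vertical sides the composite lenses ⟨f₃♯,f₃⟩ ∘ ⟨f₁♯,f₁⟩ and ⟨f₄♯,f₄⟩ ∘ ⟨f₂♯,f₂⟩ and horizontal sides ⟨g₁♯,g₁⟩ and ⟨g₃♯,g₃⟩, also commutes. -/

import Mathlib

open CategoryTheory Opposite

universe w₁ w₂ v u

variable {𝒞 : Type u} [Category.{v} 𝒞] (Bun : 𝒞ᵒᵖ ⥤ Cat.{w₁, w₂})

def re {C C' : 𝒞} (f : C ⟶ C') : ↥(Bun.obj (op C')) ⥤ ↥(Bun.obj (op C)) :=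
  (Bun.map f.op).toFunctor

theorem re_id (C : 𝒞) : re Bun (𝟙 C) = 𝟭 (Bun.obj (op C)) := by
  simp [re]

theorem re_id_obj (C : 𝒞) (A : Bun.obj (op C)) : (re Bun (𝟙 C)).obj A = A := by
  rw [re_id]; rfl

theorem re_comp {C C' C'' : 𝒞} (f : C ⟶ C') (g : C' ⟶ C'') :
    re Bun (f ≫ g) = re Bun g ⋙ re Bun f := by
  simp [re]

theorem re_comp_obj {C C' C'' : 𝒞} (f : C ⟶ C') (g : C' ⟶ C'')
    (A : Bun.obj (op C'')) :
    (re Bun (f ≫ g)).obj A = (re Bun f).obj ((re Bun g).obj A) := by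
  rw [re_comp]; rfl

/-- The strictness identification between two iterated reindexings along the two
sides of a commuting square in the base. -/
theorem re_re_obj {C₁ C₂ C₃ C₄ : 𝒞} {a : C₁ ⟶ C₃} {b : C₃ ⟶ C₄} {c : C₁ ⟶ C₂}
    {d : C₂ ⟶ C₄} (h : a ≫ b = c ≫ d) (A : Bun.obj (op C₄)) :
    (re Bun a).obj ((re Bun b).obj A) = (re Bun c).obj ((re Bun d).obj A) := by
  rw [← re_comp_obj, ← re_comp_obj, h]

structure LensObj where
  base : 𝒞
  fib : Bun.obj (op base)

/-- A lens `⟨f♯, f⟩ : ⟨A,C⟩ ⇆ ⟨A',C'⟩`. -/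
structure Lens (X Y : LensObj Bun) where
  base : X.base ⟶ Y.base
  fib : (re Bun base).obj Y.fib ⟶ X.fib

/-- A bundle map `⟨g♯, g⟩ : ⟨A,C⟩ ⇉ ⟨A',C'⟩`. -/
structure BMap (X Y : LensObj Bun) where
  base : X.base ⟶ Y.base
  fib : X.fib ⟶ (re Bun base).obj Y.fib

/-- Composition of bundle maps: `⟨h♯,h⟩ ∘ ⟨g♯,g⟩ = ⟨ι ∘ g*(h♯) ∘ g♯, g ≫ h⟩`. -/
def BMap.comp {X Y Z : LensObj Bun} (g : BMap Bun X Y) (h : BMap Bun Y Z) :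
    BMap Bun X Z where
  base := g.base ≫ h.base
  fib := g.fib ≫ (re Bun g.base).map h.fib ≫ eqToHom (re_comp_obj Bun g.base h.base Z.fib).symm

/-- Composition of lenses: `⟨g♯,g⟩ ∘ ⟨f♯,f⟩ = ⟨f♯ ∘ f*(g♯) ∘ ι, f ≫ g⟩`. -/
def Lens.comp {X Y Z : LensObj Bun} (f : Lens Bun X Y) (g : Lens Bun Y Z) :
    Lens Bun X Z where
  base := f.base ≫ g.base
  fib := eqToHom (re_comp_obj Bun f.base g.base Z.fib) ≫ (re Bun f.base).map g.fib ≫ f.fib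

/-- A square in the Grothendieck double construction, with vertical sides the lenses
`f₁` (left) and `f₂` (right) and horizontal sides the bundle maps `g₁` (top) and
`g₂` (bottom), commutes when both the base square and the fiber square commute. -/
def SquareCommutes {X₁ X₂ X₃ X₄ : LensObj Bun} (f₁ : Lens Bun X₁ X₃)
    (f₂ : Lens Bun X₂ X₄) (g₁ : BMap Bun X₁ X₂) (g₂ : BMap Bun X₃ X₄) : Prop :=
  ∃ hbase : f₁.base ≫ g₂.base = g₁.base ≫ f₂.base,
    f₁.fib ≫ g₁.fib =
      (re Bun f₁.base).map g₂.fib ≫ eqToHom (re_re_obj Bun hbase X₄.fib) ≫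
        (re Bun g₁.base).map f₂.fib

/-!
STATEMENT 2: Vertically adjacent commuting squares in the Grothendieck double
construction compose to a commuting square.
-/

theorem re_comp_map {C C' C'' : 𝒞} (f : C ⟶ C') (g : C' ⟶ C'')
    {A B : Bun.obj (op C'')} (φ : A ⟶ B) :
    (re Bun (f ≫ g)).map φ =
      eqToHom (re_comp_obj Bun f g A) ≫ (re Bun f).map ((re Bun g).map φ) ≫
        eqToHom (re_comp_obj Bun f g B).symm :=
  Functor.congr_hom (re_comp Bun f g) φ

/-- The strictness identification of a commuting square is natural. -/
theorem re_re_map {C₁ C₂ C₃ C₄ : 𝒞} {a : C₁ ⟶ C₃} {b : C₃ ⟶ C₄} {c : C₁ ⟶ C₂}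
    {d : C₂ ⟶ C₄} (h : a ≫ b = c ≫ d) {A B : Bun.obj (op C₄)} (φ : A ⟶ B) :
    (re Bun a).map ((re Bun b).map φ) ≫ eqToHom (re_re_obj Bun h B) =
      eqToHom (re_re_obj Bun h A) ≫ (re Bun c).map ((re Bun d).map φ) := by
  have hF : re Bun b ⋙ re Bun a = re Bun d ⋙ re Bun c := by
    rw [← re_comp, ← re_comp, h]
  have hφ := Functor.congr_hom hF φ
  simp only [Functor.comp_map] at hφ
  simp [hφ]

theorem vertical_composite_of_commuting_squares
    {X₁ X₂ X₃ X₄ X₅ X₆ : LensObj Bun}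
    (f₁ : Lens Bun X₁ X₃) (f₂ : Lens Bun X₂ X₄)
    (f₃ : Lens Bun X₃ X₅) (f₄ : Lens Bun X₄ X₆)
    (g₁ : BMap Bun X₁ X₂) (g₂ : BMap Bun X₃ X₄) (g₃ : BMap Bun X₅ X₆)
    (hupper : SquareCommutes Bun f₁ f₂ g₁ g₂)
    (hlower : SquareCommutes Bun f₃ f₄ g₂ g₃) :
    SquareCommutes Bun (Lens.comp Bun f₁ f₃) (Lens.comp Bun f₂ f₄) g₁ g₃ := by
  obtain ⟨hu, eu⟩ := hupper
  obtain ⟨hl, el⟩ := hlower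
  refine ⟨?_, ?_⟩
  · simp only [Lens.comp, Category.assoc, hl]
    rw [← Category.assoc, hu, Category.assoc]
  · have el' := congrArg (re Bun f₁.base).map el
    simp only [Functor.map_comp, eqToHom_map] at el'
    have hn := re_re_map Bun hu f₄.fib
    simp only [Lens.comp, Category.assoc, eu, Functor.map_comp, eqToHom_map, re_comp_map]
    rw [reassoc_of% el', reassoc_of% hn]
    erw [eqToHom_trans_assoc, eqToHom_trans_assoc, eqToHom_trans_assoc]
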